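/- Let c_t be the canonical 1-WL colorings of a finite simple graph H with initial labeling l, and let f_t be the encodings produced by a 1-GNN on H: f_0 : V → (Fin d_0 → ℝ) is given, and f_{t+1}(v) = σ ∘ (f_t(v) ⬝ᵥ W1^{(t)} + Σ_{w ∈ N(v)} f_t(w) ⬝ᵥ W2^{(t)}) for arbitrary weight matrices W1^{(t)}, W2^{(t)} : Matrix (Fin d_t) (Fin d_{t+1}) ℝ and a function σ : ℝ → ℝ applied entrywise. If the initial encoding is consistent with the initial labels (for all u, v, l(u) = l(v) implies f_0(u) = f_0(v)), then the 1-WL coloring refines the 1-GNN encoding at every layer: for all t and all u, v, c_t(u) = c_t(v) implies f_t(u) = f_t(v). -/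

import Mathlib

/-- The family of color types: `Color L 0 = L`,
`Color L (t+1) = Color L t × Multiset (Color L t)`. -/
def Color (L : Type) : ℕ → Type
  | 0 => L
  | (t + 1) => Color L t × Multiset (Color L t)

/-- The canonical 1-WL colorings of a simple graph `H` with initial labeling `l`:
`c_0 = l` and `c_{t+1}(v) = (c_t(v), {{ c_t(w) : w ∈ N(v) }})`. -/
def wl {V L : Type} [Fintype V] (H : SimpleGraph V) [DecidableRel H.Adj]
    (l : V → L) : (t : ℕ) → V → Color L t
  | 0 => l
  | (t + 1) => fun v => (wl H l t v, (H.neighborFinset v).val.map (wl H l t))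

/-- Let `c_t` be the canonical 1-WL colorings of a finite
simple graph `H` with initial labeling `l`, and let `f_t` be 1-GNN encodings:
`f_{t+1}(v) = σ ∘ (f_t(v) ⬝ᵥ W1⁽ᵗ⁾ + Σ_{w ∈ N(v)} f_t(w) ⬝ᵥ W2⁽ᵗ⁾)` for
arbitrary weight matrices and entrywise `σ`. If the initial encoding is
consistent with the initial labels, then the 1-WL coloring refines the 1-GNN
encoding at every layer: `c_t(u) = c_t(v)` implies `f_t(u) = f_t(v)`. -/
theorem wl_refines_gnn {V L : Type} [Fintype V]
    (H : SimpleGraph V) [DecidableRel H.Adj] (l : V → L)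
    (d : ℕ → ℕ) (σ : ℝ → ℝ)
    (W1 W2 : (t : ℕ) → Matrix (Fin (d t)) (Fin (d (t + 1))) ℝ)
    (f : (t : ℕ) → V → (Fin (d t) → ℝ))
    (hrec : ∀ (t : ℕ) (v : V),
      f (t + 1) v =
        σ ∘ (Matrix.vecMul (f t v) (W1 t) +
          ∑ w ∈ H.neighborFinset v, Matrix.vecMul (f t w) (W2 t)))
    (h0 : ∀ u v : V, l u = l v → f 0 u = f 0 v) :
    ∀ (t : ℕ) (u v : V), wl H l t u = wl H l t v → f t u = f t v := by
  intro t
  induction t with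
  | zero => exact h0
  | succ t ih =>
    intro u v huv
    have h1 : wl H l t u = wl H l t v := congrArg Prod.fst huv
    have h2 : (H.neighborFinset u).val.map (wl H l t)
        = (H.neighborFinset v).val.map (wl H l t) := congrArg Prod.snd huv
    have hfac : Function.FactorsThrough (f t) (wl H l t) := fun a b hab => ih a b hab
    obtain ⟨g, hg⟩ := (Function.factorsThrough_iff (f t)).1 hfac
    have hsum : ∀ x : V, ∑ w ∈ H.neighborFinset x, Matrix.vecMul (f t w) (W2 t)
        = (((H.neighborFinset x).val.map (wl H l t)).map
            (fun c => Matrix.vecMul (g c) (W2 t))).sum := by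
      intro x
      rw [Multiset.map_map, hg]
      rfl
    rw [hrec, hrec, hsum, hsum, h2, ih u v h1]
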